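/- Define μ₂(ν) as the infimum over nonzero v ∈ H¹₀((0,∞)) of (∫₀^∞ (m|v'|² + W v²) dx)/(∫₀^∞ v² dx) (this is the second lowest eigenvalue of the operator u ↦ −m u'' + W u on L²(ℝ), i.e. its lowest eigenvalue on odd functions). Then there exist constants C > 0 and ν₀ ∈ (0,1) such that for all ν ∈ (0,ν₀), |μ₂(ν) − m π²/(4L²)| ≤ C L^{−5/2}. -/

import Mathlib

open MeasureTheory Filter

/-- `m = (3/16)(1−ν)`. -/
noncomputable def m (ν : ℝ) : ℝ := 3 / 16 * (1 - ν)

/-- `L = (1/4) log(4/ν)`. -/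
noncomputable def L (ν : ℝ) : ℝ := 1 / 4 * Real.log (4 / ν)

/-- `R(x,ν) = (3/4)(1−ν)/(1+√ν cosh 2x)`. -/
noncomputable def R (x ν : ℝ) : ℝ :=
  3 / 4 * (1 - ν) / (1 + Real.sqrt ν * Real.cosh (2 * x))

/-- `r(x,ν) = √R(x,ν)`, the positive even pulse. -/
noncomputable def r (x ν : ℝ) : ℝ := Real.sqrt (R x ν)

/-- `W = m − r² + r⁴`. -/
noncomputable def W (x ν : ℝ) : ℝ := m ν - r x ν ^ 2 + r x ν ^ 4

/-- `μ₂(ν)`: the infimum of the Rayleigh quotient of `u ↦ −m u'' + W u` over nonzero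
`H¹₀((0,∞))` functions (the second lowest eigenvalue of the operator on `L²(ℝ)`, i.e.
its lowest eigenvalue on odd functions). -/
noncomputable def mu2 (ν : ℝ) : ℝ :=
  sInf {c | ∃ v : ℝ → ℝ, Differentiable ℝ v ∧ v 0 = 0 ∧ (∃ x > (0 : ℝ), v x ≠ 0) ∧
    IntegrableOn (fun x => v x ^ 2) (Set.Ioi 0) ∧
    IntegrableOn (fun x => deriv v x ^ 2) (Set.Ioi 0) ∧
    c = (∫ x in Set.Ioi (0 : ℝ), (m ν * deriv v x ^ 2 + W x ν * v x ^ 2)) /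
        (∫ x in Set.Ioi (0 : ℝ), v x ^ 2)}

/-- The profile `1/(1+s cosh 2x)`, proportional to `R` when `s = √ν`. -/
noncomputable def plateau (s x : ℝ) : ℝ := 1 / (1 + s * Real.cosh (2 * x))

/-- The logarithmic derivative of `√(plateau s)`. -/
noncomputable def logSlope (s x : ℝ) : ℝ := -(s * Real.sinh (2 * x)) / (1 + s * Real.cosh (2 * x))

/-- The derivative of `logSlope s`. -/
noncomputable def logSlopeDeriv (s x : ℝ) : ℝ :=
  -(2 * (s * Real.cosh (2 * x) + s ^ 2)) / (1 + s * Real.cosh (2 * x)) ^ 2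

lemma one_add_mul_cosh_pos {s : ℝ} (hs : 0 < s) (x : ℝ) : 0 < 1 + s * Real.cosh (2 * x) := by
  have := Real.cosh_pos (2 * x)
  positivity

lemma plateau_pos {s : ℝ} (hs : 0 < s) (x : ℝ) : 0 < plateau s x :=
  one_div_pos.2 (one_add_mul_cosh_pos hs x)

lemma plateau_le_one {s : ℝ} (hs : 0 < s) (x : ℝ) : plateau s x ≤ 1 := by
  have := Real.cosh_pos (2 * x)
  rw [plateau, div_le_one (one_add_mul_cosh_pos hs x)]
  nlinarith

lemma plateau_ge {s : ℝ} (hs : 0 < s) (x : ℝ) : 1 - s * Real.cosh (2 * x) ≤ plateau s x := by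
  rw [plateau, le_div_iff₀ (one_add_mul_cosh_pos hs x)]
  nlinarith [sq_nonneg (s * Real.cosh (2 * x))]

lemma plateau_le_exp {s : ℝ} (hs : 0 < s) (x : ℝ) : plateau s x ≤ 2 / s * Real.exp (-2 * x) := by
  have h1 := Real.exp_pos (2 * x)
  have h2 := Real.exp_pos (-(2 * x))
  have h3 : Real.exp (2 * x) * Real.exp (-(2 * x)) = 1 := by rw [← Real.exp_add]; simp
  rw [plateau, div_le_iff₀ (one_add_mul_cosh_pos hs x), Real.cosh_eq, neg_mul]
  have : 2 / s * Real.exp (-(2 * x)) *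
      (1 + s * ((Real.exp (2 * x) + Real.exp (-(2 * x))) / 2)) =
      2 / s * Real.exp (-(2 * x)) + Real.exp (2 * x) * Real.exp (-(2 * x)) +
        Real.exp (-(2 * x)) ^ 2 := by
    field_simp
    ring
  rw [this, h3]
  have : 0 < 2 / s * Real.exp (-(2 * x)) := by positivity
  nlinarith [sq_nonneg (Real.exp (-(2 * x)))]

lemma continuous_plateau {s : ℝ} (hs : 0 < s) : Continuous (plateau s) := by
  have : ∀ x, 1 + s * Real.cosh (2 * x) ≠ 0 := fun x => (one_add_mul_cosh_pos hs x).ne'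
  unfold plateau
  fun_prop (disch := assumption)

lemma continuous_logSlope {s : ℝ} (hs : 0 < s) : Continuous (logSlope s) := by
  have : ∀ x, 1 + s * Real.cosh (2 * x) ≠ 0 := fun x => (one_add_mul_cosh_pos hs x).ne'
  unfold logSlope
  fun_prop (disch := assumption)

lemma abs_logSlope_le_one {s : ℝ} (hs : 0 < s) (x : ℝ) : |logSlope s x| ≤ 1 := by
  have hc := one_add_mul_cosh_pos hs x
  have h1 := Real.exp_pos (2 * x)
  have h2 := Real.exp_pos (-(2 * x))
  rw [logSlope, abs_div, abs_of_pos hc, div_le_one hc, abs_le, Real.cosh_eq, Real.sinh_eq]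
  constructor <;> nlinarith [mul_pos hs h1, mul_pos hs h2]

lemma hasDerivAt_one_add_mul_cosh (s x : ℝ) :
    HasDerivAt (fun x => 1 + s * Real.cosh (2 * x)) (2 * (s * Real.sinh (2 * x))) x := by
  refine (((((hasDerivAt_id x).const_mul 2).cosh).const_mul s).const_add 1).congr_deriv ?_
  simp
  ring

lemma hasDerivAt_logSlope {s : ℝ} (hs : 0 < s) (x : ℝ) :
    HasDerivAt (logSlope s) (logSlopeDeriv s x) x := by
  have h1 := ((((hasDerivAt_id x).const_mul 2).sinh).const_mul s).neg
  refine (h1.div (hasDerivAt_one_add_mul_cosh s x)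
    (one_add_mul_cosh_pos hs x).ne').congr_deriv ?_
  rw [logSlopeDeriv]
  congr 1
  simp
  linear_combination (-2 * s ^ 2) * Real.cosh_sq (2 * x)

lemma hasDerivAt_sqrt_plateau {s : ℝ} (hs : 0 < s) (x : ℝ) :
    HasDerivAt (fun x => √(plateau s x)) (logSlope s x * √(plateau s x)) x := by
  have hc := one_add_mul_cosh_pos hs x
  have hp := plateau_pos hs x
  have h1 : HasDerivAt (plateau s)
      (2 * logSlope s x * plateau s x) x := by
    have hinv : plateau s = (fun x => 1 + s * Real.cosh (2 * x))⁻¹ := by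
      ext y
      simp [plateau]
    rw [hinv]
    refine ((hasDerivAt_one_add_mul_cosh s x).inv hc.ne').congr_deriv ?_
    simp only [logSlope, Pi.inv_apply]
    field_simp
  refine (h1.sqrt hp.ne').congr_deriv ?_
  have h2 : 0 < √(plateau s x) := Real.sqrt_pos.2 hp
  field_simp
  rw [Real.sq_sqrt hp.le]

lemma logSlope_sq_add_deriv {s : ℝ} (hs : 0 < s) (x : ℝ) :
    logSlope s x ^ 2 + logSlopeDeriv s x =
      1 - 4 * plateau s x + 3 * (1 - s ^ 2) * plateau s x ^ 2 := by
  have hc := one_add_mul_cosh_pos hs x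
  simp only [logSlope, logSlopeDeriv, plateau]
  field_simp
  linear_combination (- s ^ 2) * Real.cosh_sq (2 * x)

lemma W_eq {ν : ℝ} (h0 : 0 < ν) (h1 : ν < 1) (x : ℝ) :
    W x ν = m ν * (logSlope √ν x ^ 2 + logSlopeDeriv √ν x) := by
  have hs : 0 < √ν := Real.sqrt_pos.2 h0
  have hR : R x ν = 4 * m ν * plateau √ν x := by
    rw [R, m, plateau]
    ring
  have hm : 0 < m ν := by rw [m]; linarith
  have hr : r x ν ^ 2 = R x ν := by
    rw [r, Real.sq_sqrt]
    rw [hR]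
    have := plateau_pos hs x
    positivity
  have hr4 : r x ν ^ 4 = R x ν ^ 2 := by rw [← hr]; ring
  rw [logSlope_sq_add_deriv hs, W, hr4, hr, hR, Real.sq_sqrt h0.le]
  simp only [m]
  ring

lemma abs_logSlope_sq_add_deriv_le {s : ℝ} (hs : 0 < s) (hs1 : s ≤ 1) (x : ℝ) :
    |logSlope s x ^ 2 + logSlopeDeriv s x| ≤ 8 := by
  rw [logSlope_sq_add_deriv hs, abs_le]
  have h1 := (plateau_pos hs x).le
  have h2 := plateau_le_one hs x
  have h3 : 0 ≤ 1 - s ^ 2 := by nlinarith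
  have h4 : 0 ≤ (1 - s ^ 2) * plateau s x ^ 2 := by positivity
  have h5 : (1 - s ^ 2) * plateau s x ^ 2 ≤ 1 := by
    apply mul_le_one₀ <;> nlinarith
  constructor <;> nlinarith

lemma continuous_logSlope_sq_add_deriv {s : ℝ} (hs : 0 < s) :
    Continuous fun x => logSlope s x ^ 2 + logSlopeDeriv s x := by
  simp_rw [logSlope_sq_add_deriv hs]
  have := continuous_plateau hs
  fun_prop

lemma integrableOn_plateau {s : ℝ} (hs : 0 < s) : IntegrableOn (plateau s) (Set.Ioi 0) := by
  refine Integrable.mono' ((integrableOn_exp_mul_Ioi (a := -2) (by norm_num) 0).const_mul (2 / s))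
    (continuous_plateau hs).aestronglyMeasurable (Eventually.of_forall fun x => ?_)
  rw [Real.norm_of_nonneg (plateau_pos hs x).le]
  exact plateau_le_exp hs x

lemma integrableOn_plateau_mul {s M : ℝ} (hs : 0 < s) {f : ℝ → ℝ} (hf : Continuous f)
    (hM : ∀ x, |f x| ≤ M) : IntegrableOn (fun x => plateau s x * f x) (Set.Ioi 0) :=
  Integrable.mul_bdd (integrableOn_plateau hs) hf.aestronglyMeasurable (Eventually.of_forall hM)

lemma sqrt_mul_exp_two_mul_L {ν : ℝ} (h0 : 0 < ν) : √ν * Real.exp (2 * L ν) = 2 := by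
  have h1 : Real.exp (2 * L ν) ^ 2 = 4 / ν := by
    rw [← Real.exp_nat_mul, L, show ((2 : ℕ) : ℝ) * (2 * (1 / 4 * Real.log (4 / ν))) =
      Real.log (4 / ν) by push_cast; ring, Real.exp_log (by positivity)]
  have h2 : (√ν * Real.exp (2 * L ν)) ^ 2 = 2 ^ 2 := by
    rw [mul_pow, Real.sq_sqrt h0.le, h1]
    field_simp
    norm_num
  exact (pow_left_inj₀ (by positivity) (by norm_num) two_ne_zero).1 h2

lemma logSlope_le_neg_quarter {ν x : ℝ} (h0 : 0 < ν) (h1 : ν ≤ 1 / 9) (hx : L ν ≤ x)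
    (hx0 : 0 ≤ x) : logSlope √ν x ≤ -(1 / 4) := by
  have hs : 0 < √ν := Real.sqrt_pos.2 h0
  have hs1 : √ν ≤ 1 / 3 := Real.sqrt_le_iff.2 ⟨by norm_num, by norm_num; linarith⟩
  have ha : 2 ≤ √ν * Real.exp (2 * x) := by
    refine (sqrt_mul_exp_two_mul_L h0).ge.trans ?_
    gcongr
  have hb : √ν * Real.exp (-(2 * x)) ≤ 1 / 3 := by
    have : Real.exp (-(2 * x)) ≤ 1 := Real.exp_le_one_iff.2 (by linarith)
    nlinarith
  rw [logSlope, div_le_iff₀ (one_add_mul_cosh_pos hs x), Real.sinh_eq, Real.cosh_eq]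
  nlinarith

/-- The logarithmic derivative of the comparison function which equals `sin (k x)` on `[0, l]` and
continues exponentially beyond `l`. -/
noncomputable def cotSlope (k l x : ℝ) : ℝ :=
  k * (Real.cos (k * min x l) / Real.sin (k * min x l))

lemma logSlope_nonpos {s x : ℝ} (hs : 0 < s) (hx : 0 ≤ x) : logSlope s x ≤ 0 := by
  refine div_nonpos_of_nonpos_of_nonneg ?_ (one_add_mul_cosh_pos hs x).le
  have : 0 ≤ Real.sinh (2 * x) := Real.sinh_nonneg_iff.2 (by linarith)
  nlinarith

lemma mul_min_mem {k l x : ℝ} (hk : 0 < k) (hl : 0 < l) (hkl : k * l < Real.pi / 2)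
    (hx : 0 < x) : k * min x l ∈ Set.Ioo 0 (Real.pi / 2) :=
  ⟨by positivity, lt_of_le_of_lt (by gcongr; exact min_le_right x l) hkl⟩

lemma sin_mul_min_pos {k l x : ℝ} (hk : 0 < k) (hl : 0 < l) (hkl : k * l < Real.pi / 2)
    (hx : 0 < x) : 0 < Real.sin (k * min x l) := by
  have := mul_min_mem hk hl hkl hx
  exact Real.sin_pos_of_pos_of_lt_pi this.1 (by linarith [this.2, Real.pi_pos])

lemma cotSlope_nonneg {k l x : ℝ} (hk : 0 < k) (hl : 0 < l) (hkl : k * l < Real.pi / 2)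
    (hx : 0 < x) : 0 ≤ cotSlope k l x := by
  have h := mul_min_mem hk hl hkl hx
  have h1 := sin_mul_min_pos hk hl hkl hx
  have h2 := Real.cos_nonneg_of_mem_Icc ⟨by linarith [h.1, Real.pi_pos], h.2.le⟩
  unfold cotSlope
  positivity

lemma continuousAt_cotSlope {k l x : ℝ} (hk : 0 < k) (hl : 0 < l) (hkl : k * l < Real.pi / 2)
    (hx : 0 < x) : ContinuousAt (cotSlope k l) x := by
  have := (sin_mul_min_pos hk hl hkl hx).ne'
  unfold cotSlope
  fun_prop (disch := assumption)

lemma cotSlope_eq_of_le {k l x : ℝ} (hx : l ≤ x) : cotSlope k l x = cotSlope k l l := by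
  simp [cotSlope, min_eq_right hx]

lemma cotSlope_le {k l x : ℝ} (hk : 0 < k) (hl : 0 < l) (hkl : k * l < Real.pi / 2)
    (hx : 0 < x) (hxl : x ≤ l) : cotSlope k l x ≤ Real.pi / 2 / x := by
  have h := mul_min_mem hk hl hkl hx
  have h1 := Real.mul_le_sin h.1.le h.2.le
  have h3 := sin_mul_min_pos hk hl hkl hx
  have h2 := Real.cos_le_one (k * min x l)
  rw [cotSlope, ← mul_div_assoc, div_le_div_iff₀ h3 hx]
  rw [min_eq_left hxl] at *
  have h4 : k * x ≤ Real.pi / 2 * Real.sin (k * x) := by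
    have := mul_le_mul_of_nonneg_left h1 (by positivity : 0 ≤ Real.pi / 2)
    refine le_trans (le_of_eq ?_) this
    field_simp
  have : 0 < k * x := by positivity
  nlinarith

lemma exists_hasDerivWithinAt_cotSlope {s k l x : ℝ} (hs : 0 < s) (hk : 0 < k) (hl : 0 < l)
    (hkl : k * l < Real.pi / 2) (hslope : ∀ x, l ≤ x → logSlope s x ≤ -(1 / 4))
    (hc : cotSlope k l l ^ 2 + k ^ 2 ≤ cotSlope k l l / 2) (hx : 0 < x) :
    ∃ g', HasDerivWithinAt (cotSlope k l) g' (Set.Ioi x) x ∧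
      g' + cotSlope k l x ^ 2 + 2 * logSlope s x * cotSlope k l x + k ^ 2 ≤ 0 := by
  have hg := cotSlope_nonneg hk hl hkl hx
  rcases lt_or_ge x l with hxl | hxl
  · have h1 := sin_mul_min_pos hk hl hkl hx
    rw [min_eq_left hxl.le] at h1
    refine ⟨-(k ^ 2 + cotSlope k l x ^ 2), HasDerivAt.hasDerivWithinAt ?_, ?_⟩
    · have h2 : cotSlope k l =ᶠ[nhds x] fun x => k * (Real.cos (k * x) / Real.sin (k * x)) := by
        filter_upwards [Iio_mem_nhds hxl] with y hy
        rw [cotSlope, min_eq_left (le_of_lt hy)]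
      refine HasDerivAt.congr_of_eventuallyEq ?_ h2
      have h3 : HasDerivAt (fun x => k * x) k x := by simpa using (hasDerivAt_id x).const_mul k
      refine ((h3.cos.div h3.sin h1.ne').const_mul k).congr_deriv ?_
      rw [cotSlope, min_eq_left hxl.le]
      field_simp
      ring
    · have := logSlope_nonpos hs hx.le
      nlinarith
  · refine ⟨0, ?_, ?_⟩
    · refine (hasDerivWithinAt_const x _ (cotSlope k l l)).congr (fun y hy => ?_) ?_
      · exact cotSlope_eq_of_le (hxl.trans (le_of_lt hy))
      · exact cotSlope_eq_of_le hxl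
    · rw [cotSlope_eq_of_le hxl] at hg ⊢
      have := hslope x hxl
      nlinarith

lemma continuousWithinAt_cotSlope_mul_sq {k l : ℝ} (hk : 0 < k) (hl : 0 < l)
    (hkl : k * l < Real.pi / 2) {v : ℝ → ℝ} (hv : Differentiable ℝ v) (hv0 : v 0 = 0) :
    ContinuousWithinAt (fun x => cotSlope k l x * v x ^ 2) (Set.Ici 0) 0 := by
  have h1 : Tendsto (fun x => Real.pi / 2 * (|v x| * |dslope v 0 x|))
      (nhdsWithin 0 (Set.Ici 0)) (nhds 0) := by
    have : ContinuousAt (fun x => Real.pi / 2 * (|v x| * |dslope v 0 x|)) 0 := by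
      have h2 : ContinuousAt (dslope v 0) 0 := continuousAt_dslope_same.2 (hv 0)
      have h3 : ContinuousAt v 0 := (hv 0).continuousAt
      fun_prop
    have h4 := this.tendsto
    simp only [hv0, abs_zero, zero_mul, mul_zero] at h4
    exact h4.mono_left nhdsWithin_le_nhds
  rw [ContinuousWithinAt, hv0]
  simp only [ne_eq, OfNat.ofNat_ne_zero, not_false_eq_true, zero_pow, mul_zero]
  refine squeeze_zero_norm' ?_ h1
  filter_upwards [self_mem_nhdsWithin, nhdsWithin_le_nhds (Iio_mem_nhds hl)] with x hx hxl
  rcases eq_or_lt_of_le (Set.mem_Ici.1 hx) with rfl | hx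
  · simp [hv0]
  have h5 := cotSlope_le hk hl hkl hx (le_of_lt hxl)
  have h6 : v x = x * dslope v 0 x := by
    have := sub_smul_dslope v 0 x
    simpa [hv0] using this.symm
  rw [Real.norm_of_nonneg (mul_nonneg (cotSlope_nonneg hk hl hkl hx) (sq_nonneg _)), ← abs_mul]
  calc cotSlope k l x * v x ^ 2 ≤ Real.pi / 2 / x * v x ^ 2 := by gcongr
    _ = Real.pi / 2 * (v x * dslope v 0 x) := by
      rw [h6]
      field_simp
    _ ≤ _ := by
      gcongr
      exact le_abs_self _

lemma tendsto_sq_atTop_zero {v : ℝ → ℝ} (hv : Differentiable ℝ v)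
    (h2 : IntegrableOn (fun x => v x ^ 2) (Set.Ioi 0))
    (h3 : IntegrableOn (fun x => deriv v x ^ 2) (Set.Ioi 0)) :
    Tendsto (fun x => v x ^ 2) atTop (nhds 0) := by
  refine tendsto_zero_of_hasDerivAt_of_integrableOn_Ioi (a := 0)
    (f' := fun x => 2 * v x * deriv v x) (fun x _ => ?_) ?_ h2
  · refine ((hv x).hasDerivAt.pow 2).congr_deriv ?_
    simp
  · refine Integrable.mono' (h2.add h3) ?_ (Eventually.of_forall fun x => ?_)
    · have := measurable_deriv v
      have := hv.continuous.measurable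
      fun_prop
    · rw [Real.norm_eq_abs, abs_le, Pi.add_apply]
      constructor <;> nlinarith [sq_nonneg (v x + deriv v x), sq_nonneg (v x - deriv v x)]

lemma integrableOn_potential_mul_sq {s : ℝ} (hs : 0 < s) (hs1 : s ≤ 1) {v : ℝ → ℝ}
    (h2 : IntegrableOn (fun x => v x ^ 2) (Set.Ioi 0)) :
    IntegrableOn (fun x => (logSlope s x ^ 2 + logSlopeDeriv s x) * v x ^ 2) (Set.Ioi 0) :=
  Integrable.bdd_mul h2 (continuous_logSlope_sq_add_deriv hs).aestronglyMeasurable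
    (Eventually.of_forall fun x => abs_logSlope_sq_add_deriv_le hs hs1 x)

/-- A Jacobi-type lower bound for the quadratic form, from a Riccati inequality for
`logSlope s + cotSlope k l`. -/
lemma mul_integral_sq_le {s k l : ℝ} (hs : 0 < s) (hs1 : s ≤ 1) (hk : 0 < k) (hl : 0 < l)
    (hkl : k * l < Real.pi / 2) (hslope : ∀ x, l ≤ x → logSlope s x ≤ -(1 / 4))
    (hc : cotSlope k l l ^ 2 + k ^ 2 ≤ cotSlope k l l / 2)
    {v : ℝ → ℝ} (hv : Differentiable ℝ v) (hv0 : v 0 = 0)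
    (h2 : IntegrableOn (fun x => v x ^ 2) (Set.Ioi 0))
    (h3 : IntegrableOn (fun x => deriv v x ^ 2) (Set.Ioi 0)) :
    k ^ 2 * ∫ x in Set.Ioi (0 : ℝ), v x ^ 2 ≤
      ∫ x in Set.Ioi (0 : ℝ),
        (deriv v x ^ 2 + (logSlope s x ^ 2 + logSlopeDeriv s x) * v x ^ 2) := by
  have h4 := integrableOn_potential_mul_sq hs hs1 h2
  set φ : ℝ → ℝ := fun x =>
    (deriv v x ^ 2 + (logSlope s x ^ 2 + logSlopeDeriv s x) * v x ^ 2) - k ^ 2 * v x ^ 2 with hφ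
  have hφi : IntegrableOn φ (Set.Ioi 0) := (h3.add h4).sub (h2.const_mul (k ^ 2))
  have hφe : ∫ x in Set.Ioi (0 : ℝ), φ x = (∫ x in Set.Ioi (0 : ℝ),
        (deriv v x ^ 2 + (logSlope s x ^ 2 + logSlopeDeriv s x) * v x ^ 2)) -
      k ^ 2 * ∫ x in Set.Ioi (0 : ℝ), v x ^ 2 := by
    rw [← integral_const_mul]
    exact integral_sub (h3.add h4) (h2.const_mul (k ^ 2))
  rw [← sub_nonneg, ← hφe]
  set F : ℝ → ℝ := fun x => logSlope s x * v x ^ 2 + cotSlope k l x * v x ^ 2 with hF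
  have hFtend : Tendsto F atTop (nhds 0) := by
    have h5 := (tendsto_sq_atTop_zero hv h2 h3).const_mul (1 + cotSlope k l l)
    rw [mul_zero] at h5
    refine squeeze_zero_norm' ?_ h5
    filter_upwards [eventually_ge_atTop l] with x hx
    have h6 := cotSlope_nonneg hk hl hkl hl
    have h7 := abs_le.1 (abs_logSlope_le_one hs x)
    have h8 := sq_nonneg (v x)
    simp only [hF]
    rw [cotSlope_eq_of_le hx, Real.norm_eq_abs, abs_le]
    constructor <;> nlinarith [mul_nonneg h6 h8]
  have hcont : ∀ T, ContinuousOn F (Set.Icc 0 T) := by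
    intro T x hx
    have hhv : Continuous fun x => logSlope s x * v x ^ 2 :=
      (continuous_logSlope hs).mul (hv.continuous.pow 2)
    refine hhv.continuousWithinAt.add ?_
    rcases eq_or_lt_of_le hx.1 with rfl | hx0
    · exact (continuousWithinAt_cotSlope_mul_sq hk hl hkl hv hv0).mono Set.Icc_subset_Ici_self
    · exact ((continuousAt_cotSlope hk hl hkl hx0).mul
        (hv.continuous.pow 2).continuousAt).continuousWithinAt
  choose! g' hg' hle using fun x (hx : 0 < x) =>
    exists_hasDerivWithinAt_cotSlope hs hk hl hkl hslope hc hx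
  have hmain : ∀ T, 0 ≤ T → F T ≤ ∫ x in (0 : ℝ)..T, φ x := by
    intro T hT
    have h9 := intervalIntegral.sub_le_integral_of_hasDeriv_right_of_le (φ := φ)
      (g' := fun x => logSlopeDeriv s x * v x ^ 2 + logSlope s x * (2 * v x * deriv v x) +
        (g' x * v x ^ 2 + cotSlope k l x * (2 * v x * deriv v x))) hT (hcont T)
      (fun x hx => ?_) ?_ (fun x hx => ?_)
    · simpa [hF, hv0] using h9
    · have hd : HasDerivAt (fun x => v x ^ 2) (2 * v x * deriv v x) x := by
        refine ((hv x).hasDerivAt.pow 2).congr_deriv ?_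
        simp
      exact ((hasDerivAt_logSlope hs x).mul hd).hasDerivWithinAt.add
        ((hg' x hx.1).mul hd.hasDerivWithinAt)
    · rw [integrableOn_Icc_iff_integrableOn_Ioc]
      exact hφi.mono_set Set.Ioc_subset_Ioi_self
    · have h10 := mul_nonneg (neg_nonneg.2 (hle x hx.1)) (sq_nonneg (v x))
      simp only [hφ]
      nlinarith [sq_nonneg (deriv v x - (logSlope s x + cotSlope k l x) * v x)]
  exact le_of_tendsto_of_tendsto hFtend
    (intervalIntegral_tendsto_integral_Ioi 0 hφi tendsto_id)
    ((eventually_ge_atTop 0).mono hmain)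

/-- The trial function `√(plateau s) · sin (k x)`. -/
noncomputable def trial (s k x : ℝ) : ℝ := √(plateau s x) * Real.sin (k * x)

lemma hasDerivAt_trial {s : ℝ} (hs : 0 < s) (k x : ℝ) :
    HasDerivAt (trial s k)
      (√(plateau s x) * (logSlope s x * Real.sin (k * x) + k * Real.cos (k * x))) x := by
  have h3 : HasDerivAt (fun x => k * x) k x := by simpa using (hasDerivAt_id x).const_mul k
  refine ((hasDerivAt_sqrt_plateau hs x).mul h3.sin).congr_deriv ?_
  ring

lemma trial_sq {s : ℝ} (hs : 0 < s) (k x : ℝ) :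
    trial s k x ^ 2 = plateau s x * Real.sin (k * x) ^ 2 := by
  rw [trial, mul_pow, Real.sq_sqrt (plateau_pos hs x).le]

lemma deriv_trial_sq {s : ℝ} (hs : 0 < s) (k x : ℝ) :
    deriv (trial s k) x ^ 2 =
      plateau s x * (logSlope s x * Real.sin (k * x) + k * Real.cos (k * x)) ^ 2 := by
  rw [(hasDerivAt_trial hs k x).deriv, mul_pow, Real.sq_sqrt (plateau_pos hs x).le]

lemma integrableOn_trial_sq {s : ℝ} (hs : 0 < s) (k : ℝ) :
    IntegrableOn (fun x => trial s k x ^ 2) (Set.Ioi 0) := by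
  simp_rw [trial_sq hs]
  refine integrableOn_plateau_mul (M := 1) hs (by fun_prop) fun x => ?_
  rw [abs_of_nonneg (sq_nonneg _)]
  exact Real.sin_sq_le_one _

lemma integrableOn_deriv_trial_sq {s k : ℝ} (hs : 0 < s) (hk : 0 < k) :
    IntegrableOn (fun x => deriv (trial s k) x ^ 2) (Set.Ioi 0) := by
  simp_rw [deriv_trial_sq hs]
  have hc := continuous_logSlope hs
  refine integrableOn_plateau_mul (M := (1 + k) ^ 2) hs (by fun_prop) fun x => ?_
  rw [abs_of_nonneg (sq_nonneg _), sq_le_sq, abs_of_pos (by linarith : 0 < 1 + k)]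
  refine (abs_add_le _ _).trans ?_
  rw [abs_mul, abs_mul, abs_of_pos hk]
  gcongr
  · exact mul_le_one₀ (abs_logSlope_le_one hs x) (abs_nonneg _) (Real.abs_sin_le_one _)
  · exact mul_le_of_le_one_right hk.le (Real.abs_cos_le_one _)

lemma integrableOn_plateau_mul_cos_sq {s : ℝ} (hs : 0 < s) (k : ℝ) :
    IntegrableOn (fun x => plateau s x * Real.cos (k * x) ^ 2) (Set.Ioi 0) := by
  refine integrableOn_plateau_mul (M := 1) hs (by fun_prop) fun x => ?_
  rw [abs_of_nonneg (sq_nonneg _)]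
  exact Real.cos_sq_le_one _

/-- The quadratic form at the trial function is that of `sin (k x)` with weight `plateau s`. -/
lemma integral_trial {s k : ℝ} (hs : 0 < s) (hs1 : s ≤ 1) (hk : 0 < k) :
    ∫ x in Set.Ioi (0 : ℝ), (deriv (trial s k) x ^ 2 +
        (logSlope s x ^ 2 + logSlopeDeriv s x) * trial s k x ^ 2) =
      k ^ 2 * ∫ x in Set.Ioi (0 : ℝ), plateau s x * Real.cos (k * x) ^ 2 := by
  have hv : Differentiable ℝ (trial s k) := fun x => (hasDerivAt_trial hs k x).differentiableAt
  have hi1 := (integrableOn_deriv_trial_sq hs hk).add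
    (integrableOn_potential_mul_sq hs hs1 (integrableOn_trial_sq hs k))
  have hi2 := (integrableOn_plateau_mul_cos_sq hs k).const_mul (k ^ 2)
  rw [← sub_eq_zero, ← integral_const_mul]
  refine (integral_sub hi1 hi2).symm.trans ?_
  have h := integral_Ioi_of_hasDerivAt_of_tendsto (a := 0) (m := 0)
    (f := fun x => logSlope s x * trial s k x ^ 2) (f' := fun x =>
      (deriv (trial s k) x ^ 2 + (logSlope s x ^ 2 + logSlopeDeriv s x) * trial s k x ^ 2) -
        k ^ 2 * (plateau s x * Real.cos (k * x) ^ 2)) ?_ (fun x _ => ?_) (hi1.sub hi2) ?_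
  · refine h.trans ?_
    simp [trial]
  · exact ((continuous_logSlope hs).mul (hv.continuous.pow 2)).continuousWithinAt
  · refine ((hasDerivAt_logSlope hs x).mul ((hasDerivAt_trial hs k x).pow 2)).congr_deriv ?_
    simp only [Pi.pow_apply]
    rw [deriv_trial_sq hs, trial_sq hs]
    simp only [trial]
    have := Real.sq_sqrt (plateau_pos hs x).le
    push_cast
    rw [pow_one]
    linear_combination (2 * logSlope s x * Real.sin (k * x) *
      (logSlope s x * Real.sin (k * x) + k * Real.cos (k * x))) * this
  · refine squeeze_zero_norm' (Eventually.of_forall fun x => ?_)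
      (tendsto_sq_atTop_zero hv (integrableOn_trial_sq hs k) (integrableOn_deriv_trial_sq hs hk))
    rw [norm_mul, Real.norm_of_nonneg (sq_nonneg (trial s k x))]
    exact mul_le_of_le_one_left (sq_nonneg _) (abs_logSlope_le_one hs x)

lemma integral_cos_mul_sq {k l : ℝ} (hk : 0 < k) (hkl : k * l = Real.pi / 2) :
    ∫ x in (0 : ℝ)..l, Real.cos (k * x) ^ 2 = l / 2 := by
  rw [intervalIntegral.integral_comp_mul_left (fun x => Real.cos x ^ 2) hk.ne', integral_cos_sq,
    hkl]
  simp
  rw [← hkl]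
  field_simp

lemma integral_sin_mul_sq {k l : ℝ} (hk : 0 < k) (hkl : k * l = Real.pi / 2) :
    ∫ x in (0 : ℝ)..l, Real.sin (k * x) ^ 2 = l / 2 := by
  rw [intervalIntegral.integral_comp_mul_left (fun x => Real.sin x ^ 2) hk.ne', integral_sin_sq,
    hkl]
  simp
  rw [← hkl]
  field_simp

lemma integral_plateau_mul_cos_sq_le {s k l : ℝ} (hs : 0 < s) (hk : 0 < k) (hl : 0 < l)
    (hkl : k * l = Real.pi / 2) (hsl : s * Real.exp (2 * l) = 2) :
    ∫ x in Set.Ioi (0 : ℝ), plateau s x * Real.cos (k * x) ^ 2 ≤ l / 2 + 1 / 2 := by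
  have hi := integrableOn_plateau_mul_cos_sq hs k
  have hil := hi.mono_set (Set.Ioi_subset_Ioi hl.le)
  rw [← intervalIntegral.integral_interval_add_Ioi hi hil]
  have hc := continuous_plateau hs
  refine add_le_add ?_ ?_
  · rw [← integral_cos_mul_sq hk hkl]
    refine intervalIntegral.integral_mono_on hl.le (Continuous.intervalIntegrable (by fun_prop) _ _)
      (Continuous.intervalIntegrable (by fun_prop) _ _) fun x _ => ?_
    exact mul_le_of_le_one_left (sq_nonneg _) (plateau_le_one hs x)
  · have hie := (integrableOn_exp_mul_Ioi (a := -2) (by norm_num) l).const_mul (2 / s)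
    refine (integral_mono hil hie fun x => ?_).trans (le_of_eq ?_)
    · exact (mul_le_of_le_one_right (plateau_pos hs x).le (Real.cos_sq_le_one _)).trans
        (plateau_le_exp hs x)
    · rw [integral_const_mul, integral_exp_mul_Ioi (by norm_num), neg_mul 2 l, Real.exp_neg]
      have := Real.exp_pos (2 * l)
      field_simp
      linarith

lemma le_integral_trial_sq {s k l : ℝ} (hs : 0 < s) (hk : 0 < k) (hl : 0 < l)
    (hkl : k * l = Real.pi / 2) (hsl : s * Real.exp (2 * l) = 2) :
    l / 2 - 1 / 2 ≤ ∫ x in Set.Ioi (0 : ℝ), trial s k x ^ 2 := by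
  have hi := integrableOn_trial_sq hs k
  have hil := hi.mono_set (Set.Ioi_subset_Ioi hl.le)
  rw [← intervalIntegral.integral_interval_add_Ioi hi hil]
  have hc := continuous_plateau hs
  have h1 : 0 ≤ ∫ x in Set.Ioi l, trial s k x ^ 2 := integral_nonneg fun x => sq_nonneg _
  refine le_add_of_le_of_nonneg ?_ h1
  have h2 : ∫ x in (0 : ℝ)..l, s * Real.cosh (2 * x) ≤ 1 / 2 := by
    have h3 : ∀ x ∈ Set.uIcc 0 l,
        HasDerivAt (fun x => s / 2 * Real.sinh (2 * x)) (s * Real.cosh (2 * x)) x := by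
      intro x _
      refine ((((hasDerivAt_id x).const_mul 2).sinh).const_mul (s / 2)).congr_deriv ?_
      simp
      ring
    rw [intervalIntegral.integral_eq_sub_of_hasDerivAt h3
      (Continuous.intervalIntegrable (by fun_prop) _ _), Real.sinh_eq]
    have := mul_pos hs (Real.exp_pos (-(2 * l)))
    simp
    linarith
  have h4 : ∫ x in (0 : ℝ)..l, (Real.sin (k * x) ^ 2 - s * Real.cosh (2 * x)) ≤
      ∫ x in (0 : ℝ)..l, trial s k x ^ 2 := by
    simp_rw [trial_sq hs]
    refine intervalIntegral.integral_mono_on hl.le (Continuous.intervalIntegrable (by fun_prop) _ _)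
      (Continuous.intervalIntegrable (by fun_prop) _ _) fun x _ => ?_
    have h5 := plateau_ge hs x
    have h6 := Real.sin_sq_le_one (k * x)
    have h7 := sq_nonneg (Real.sin (k * x))
    have h8 := plateau_le_one hs x
    nlinarith
  rw [intervalIntegral.integral_sub (Continuous.intervalIntegrable (by fun_prop) _ _)
    (Continuous.intervalIntegrable (by fun_prop) _ _), integral_sin_mul_sq hk hkl] at h4
  linarith

lemma integral_form_eq {ν : ℝ} (h0 : 0 < ν) (h1 : ν < 1) (v : ℝ → ℝ) :
    ∫ x in Set.Ioi (0 : ℝ), (m ν * deriv v x ^ 2 + W x ν * v x ^ 2) =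
      m ν * ∫ x in Set.Ioi (0 : ℝ),
        (deriv v x ^ 2 + (logSlope √ν x ^ 2 + logSlopeDeriv √ν x) * v x ^ 2) := by
  rw [← integral_const_mul]
  congr 1
  ext x
  rw [W_eq h0 h1]
  ring

lemma four_le_L {ν : ℝ} (h0 : 0 < ν) (h1 : ν < Real.exp (-16)) : 4 ≤ L ν := by
  have : 16 ≤ Real.log (4 / ν) := by
    rw [Real.le_log_iff_exp_le (by positivity), le_div_iff₀ h0]
    have h2 : Real.exp 16 * Real.exp (-16) = 1 := by rw [← Real.exp_add]; simp
    nlinarith [Real.exp_pos 16]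
  rw [L]
  linarith

lemma lt_one_ninth {ν : ℝ} (h1 : ν < Real.exp (-16)) : ν < 1 / 9 := by
  refine h1.trans_le ?_
  rw [Real.exp_neg, one_div]
  gcongr
  linarith [Real.add_one_le_exp 16]

lemma cotSlope_riccati {l : ℝ} (hl : 4 ≤ l) :
    cotSlope (Real.pi / (2 * (l + 4))) l l ^ 2 + (Real.pi / (2 * (l + 4))) ^ 2 ≤
      cotSlope (Real.pi / (2 * (l + 4))) l l / 2 := by
  set k := Real.pi / (2 * (l + 4)) with hk
  have hk0 : 0 < k := by positivity
  have hk1 : 4 * k ≤ Real.pi / 4 := by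
    rw [hk, ← mul_div_assoc, div_le_div_iff₀ (by positivity) (by norm_num)]
    nlinarith [Real.pi_pos]
  have hkl : k * l = Real.pi / 2 - 4 * k := by
    rw [hk]
    field_simp
    ring
  have hg : cotSlope k l l = k * Real.tan (4 * k) := by
    rw [cotSlope, min_self, hkl, Real.cos_pi_div_two_sub, Real.sin_pi_div_two_sub,
      Real.tan_eq_sin_div_cos]
  have h1 : 4 * k ≤ Real.tan (4 * k) :=
    Real.le_tan (by positivity) (by linarith [Real.pi_pos])
  have h2 : Real.tan (4 * k) ≤ 1 := by
    rw [← Real.tan_pi_div_four]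
    rcases hk1.eq_or_lt with h | h
    · rw [h]
    · exact (Real.tan_lt_tan_of_lt_of_lt_pi_div_two (by linarith [Real.pi_pos])
        (by linarith [Real.pi_pos]) h).le
  have h3 : k ≤ 1 / 4 := by linarith [Real.pi_lt_four]
  rw [hg]
  nlinarith [mul_le_mul_of_nonneg_left h1 hk0.le,
    mul_le_mul_of_nonneg_left (mul_le_one₀ h2 (by linarith) h2) (sq_nonneg k),
    mul_le_mul h3 h2 (by linarith) (by norm_num)]

lemma integral_sq_pos {v : ℝ → ℝ} (hv : Continuous v) (hne : ∃ x > (0 : ℝ), v x ≠ 0)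
    (hi : IntegrableOn (fun x => v x ^ 2) (Set.Ioi 0)) :
    0 < ∫ x in Set.Ioi (0 : ℝ), v x ^ 2 := by
  rw [setIntegral_pos_iff_support_of_nonneg_ae (Eventually.of_forall fun x => sq_nonneg (v x)) hi]
  obtain ⟨x, hx, hvx⟩ := hne
  have ho : IsOpen (Function.support (fun x => v x ^ 2) ∩ Set.Ioi 0) :=
    (hv.pow 2).isOpen_support.inter isOpen_Ioi
  exact ho.measure_pos _ ⟨x, by simpa using hvx, hx⟩

/-- The set of Rayleigh quotients whose infimum is `mu2 ν`. -/
def rayleighSet (ν : ℝ) : Set ℝ :=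
  {c | ∃ v : ℝ → ℝ, Differentiable ℝ v ∧ v 0 = 0 ∧ (∃ x > (0 : ℝ), v x ≠ 0) ∧
    IntegrableOn (fun x => v x ^ 2) (Set.Ioi 0) ∧
    IntegrableOn (fun x => deriv v x ^ 2) (Set.Ioi 0) ∧
    c = (∫ x in Set.Ioi (0 : ℝ), (m ν * deriv v x ^ 2 + W x ν * v x ^ 2)) /
        (∫ x in Set.Ioi (0 : ℝ), v x ^ 2)}

lemma mem_lowerBounds_rayleighSet {ν : ℝ} (h0 : 0 < ν) (h1 : ν < Real.exp (-16)) :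
    m ν * (Real.pi / (2 * (L ν + 4))) ^ 2 ∈ lowerBounds (rayleighSet ν) := by
  rintro c ⟨v, hv, hv0, hne, h2, h3, rfl⟩
  have hL := four_le_L h0 h1
  have hν := lt_one_ninth h1
  have hs : 0 < √ν := Real.sqrt_pos.2 h0
  have hs1 : √ν ≤ 1 := Real.sqrt_le_one.2 (by linarith)
  have hm : 0 < m ν := by rw [m]; linarith
  rw [le_div_iff₀ (integral_sq_pos hv.continuous hne h2), integral_form_eq h0 (by linarith),
    mul_assoc]
  refine mul_le_mul_of_nonneg_left (mul_integral_sq_le hs hs1 (by positivity)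
    (by linarith : 0 < L ν) ?_
    (fun x hx => logSlope_le_neg_quarter h0 hν.le hx (by linarith)) (cotSlope_riccati hL)
    hv hv0 h2 h3) hm.le
  rw [div_mul_eq_mul_div, div_lt_div_iff₀ (by positivity) (by norm_num)]
  nlinarith [Real.pi_pos]

lemma exists_mem_rayleighSet_le {ν : ℝ} (h0 : 0 < ν) (h1 : ν < Real.exp (-16)) :
    ∃ c ∈ rayleighSet ν,
      c ≤ m ν * (Real.pi / (2 * L ν)) ^ 2 * ((L ν + 1) / (L ν - 1)) := by
  have hL := four_le_L h0 h1
  have hν := lt_one_ninth h1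
  have hs : 0 < √ν := Real.sqrt_pos.2 h0
  have hs1 : √ν ≤ 1 := Real.sqrt_le_one.2 (by linarith)
  have hm : 0 < m ν := by rw [m]; linarith
  have hl : 0 < L ν := by linarith
  have hL1 : 0 < L ν - 1 := by linarith
  set k := Real.pi / (2 * L ν) with hk
  have hk0 : 0 < k := by positivity
  have hkl : k * L ν = Real.pi / 2 := by
    rw [hk]
    field_simp
  have hsl := sqrt_mul_exp_two_mul_L h0
  refine ⟨_, ⟨trial √ν k, fun x => (hasDerivAt_trial hs k x).differentiableAt, by simp [trial],
    ⟨L ν, hl, ?_⟩, integrableOn_trial_sq hs k, integrableOn_deriv_trial_sq hs hk0, rfl⟩, ?_⟩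
  · rw [trial, hkl, Real.sin_pi_div_two, mul_one]
    exact (Real.sqrt_pos.2 (plateau_pos hs _)).ne'
  · have hA := integral_plateau_mul_cos_sq_le hs hk0 hl hkl hsl
    have hB := le_integral_trial_sq hs hk0 hl hkl hsl
    have hB0 : 0 < ∫ x in Set.Ioi (0 : ℝ), trial √ν k x ^ 2 := by linarith
    rw [integral_form_eq h0 (by linarith), integral_trial hs hs1 hk0, ← mul_assoc, mul_div_assoc]
    refine mul_le_mul_of_nonneg_left ?_ (by positivity)
    rw [div_le_div_iff₀ hB0 hL1]
    nlinarith

/-- `|μ₂(ν) − mπ²/(4L²)| ≤ C L^{−5/2}` for all small `ν`. -/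
theorem second_eigenvalue_asymptotics :
    ∃ C > 0, ∃ ν₀ ∈ Set.Ioo (0 : ℝ) 1, ∀ ν ∈ Set.Ioo (0 : ℝ) ν₀,
      |mu2 ν - m ν * Real.pi ^ 2 / (4 * L ν ^ 2)| ≤ C * L ν ^ (-(5 : ℝ) / 2) := by
  refine ⟨4, by norm_num, Real.exp (-16), ⟨Real.exp_pos _, by simp⟩, ?_⟩
  rintro ν ⟨h0, h1⟩
  have hL := four_le_L h0 h1
  have hν := lt_one_ninth h1
  have hm : 0 ≤ m ν := by rw [m]; linarith
  have hm1 : m ν ≤ 3 / 16 := by rw [m]; linarith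
  have hlow := mem_lowerBounds_rayleighSet h0 h1
  obtain ⟨c, hc, hcle⟩ := exists_mem_rayleighSet_le h0 h1
  have hmu : mu2 ν = sInf (rayleighSet ν) := rfl
  have hge : m ν * (Real.pi / (2 * (L ν + 4))) ^ 2 ≤ mu2 ν := by
    rw [hmu]
    exact le_csInf ⟨c, hc⟩ hlow
  have hle : mu2 ν ≤ m ν * (Real.pi / (2 * L ν)) ^ 2 * ((L ν + 1) / (L ν - 1)) := by
    rw [hmu]
    exact (csInf_le ⟨_, hlow⟩ hc).trans hcle
  have hpow : 1 / L ν ^ 3 ≤ L ν ^ (-(5 : ℝ) / 2) := by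
    rw [one_div, ← Real.rpow_natCast, ← Real.rpow_neg (by linarith)]
    exact Real.rpow_le_rpow_of_exponent_le (by linarith) (by norm_num)
  refine le_trans ?_ (mul_le_mul_of_nonneg_left hpow (by norm_num))
  generalize L ν = l at *
  generalize m ν = a at *
  have hpi : Real.pi ^ 2 ≤ 10 := by nlinarith [Real.pi_lt_d2, Real.pi_pos]
  have hl0 : 0 < l := by linarith
  have hl1 : 0 < l - 1 := by linarith
  have hap : a * Real.pi ^ 2 ≤ 15 / 8 := by nlinarith [sq_nonneg Real.pi]
  have hap0 : 0 ≤ a * Real.pi ^ 2 := by positivity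
  have hup : a * (Real.pi / (2 * l)) ^ 2 * ((l + 1) / (l - 1)) - a * Real.pi ^ 2 / (4 * l ^ 2) =
      a * Real.pi ^ 2 * (1 / (2 * l ^ 2 * (l - 1))) := by
    field_simp
    ring
  have hup2 : 1 / (2 * l ^ 2 * (l - 1)) ≤ 1 / l ^ 3 :=
    one_div_le_one_div_of_le (by positivity) (by nlinarith [sq_nonneg l])
  have hdn : a * Real.pi ^ 2 / (4 * l ^ 2) - a * (Real.pi / (2 * (l + 4))) ^ 2 =
      a * Real.pi ^ 2 * ((2 * l + 4) / (l ^ 2 * (l + 4) ^ 2)) := by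
    field_simp
    ring
  have hdn2 : (2 * l + 4) / (l ^ 2 * (l + 4) ^ 2) ≤ 2 * (1 / l ^ 3) := by
    rw [← mul_div_assoc, mul_one, div_le_div_iff₀ (by positivity) (by positivity)]
    nlinarith [pow_pos hl0 2, pow_pos hl0 3]
  have hl3 : 0 < 1 / l ^ 3 := by positivity
  rw [abs_le]
  constructor
  · nlinarith [mul_le_mul_of_nonneg_left hdn2 hap0]
  · nlinarith [mul_le_mul_of_nonneg_left hup2 hap0]
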